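/- Let A = {1,…,k} with k ≥ 3, and let S be the set of gates 1-SWAP_{a,b} for all a ≠ b ∈ A. Then S generates c-SWAP_{a,b} for all a, b, c ∈ A. -/

import Mathlib

/-- A reversible gate function of arity `n` over alphabet `A`: a bijection `A^n → A^n`. -/
abbrev GateFun (A : Type*) (n : ℕ) := (Fin n → A) ≃ (Fin n → A)

/-- A reversible gate over alphabet `A`: an arity together with a bijection of that arity. -/
abbrev Gate (A : Type*) := Σ n : ℕ, GateFun A n

/-- The canonical identification `A^{n+m} ≃ A^n × A^m`. -/
def splitEquiv (A : Type*) (n m : ℕ) :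
    (Fin (n + m) → A) ≃ ((Fin n → A) × (Fin m → A)) :=
  (Equiv.arrowCongr finSumFinEquiv.symm (Equiv.refl A)).trans
    (Equiv.sumArrowEquivProdArrow _ _ A)

/-- The permutation gate `P_σ`, mapping `(a_1,…,a_n)` to `(a_{σ(1)},…,a_{σ(n)})`. -/
def permGate (A : Type*) {n : ℕ} (σ : Equiv.Perm (Fin n)) : GateFun A n :=
  Equiv.arrowCongr σ.symm (Equiv.refl A)

/-- Tensor product of gates. -/
def tensorGate {A : Type*} {n m : ℕ} (F : GateFun A n) (G : GateFun A m) :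
    GateFun A (n + m) :=
  ((splitEquiv A n m).trans (F.prodCongr G)).trans (splitEquiv A n m).symm

/-- The generation relation: `Generates S g` means `g` can be generated from the set `S`
of reversible gates using the permutation, tensor product, composition and ancilla rules. -/
inductive Generates {A : Type*} (S : Set (Gate A)) : Gate A → Prop
  | mem {g : Gate A} : g ∈ S → Generates S g
  | perm (n : ℕ) (σ : Equiv.Perm (Fin n)) : Generates S ⟨n, permGate A σ⟩
  | tensor {n m : ℕ} {F : GateFun A n} {G : GateFun A m} :
      Generates S ⟨n, F⟩ → Generates S ⟨m, G⟩ → Generates S ⟨n + m, tensorGate F G⟩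
  | comp {n : ℕ} {F G : GateFun A n} :
      Generates S ⟨n, F⟩ → Generates S ⟨n, G⟩ → Generates S ⟨n, G.trans F⟩
  | ancilla {l m : ℕ} {F : GateFun A (l + m)} (a : Fin l → A) {F' : GateFun A m} :
      Generates S ⟨l + m, F⟩ →
      (∀ b : Fin m → A,
        F ((splitEquiv A l m).symm (a, b)) = (splitEquiv A l m).symm (a, F' b)) →
      Generates S ⟨m, F'⟩

/-- The gate class `⟨S⟩` generated by a set `S` of reversible gates. -/
def genClosure {A : Type*} (S : Set (Gate A)) : Set (Gate A) := {g | Generates S g}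

/-- A reversible gate class: a set of gates closed under the generation rules. -/
def IsGateClass {A : Type*} (S : Set (Gate A)) : Prop := ∀ g, Generates S g → g ∈ S

/-- The transposition gate `τ_{u,v}` exchanging the inputs `u` and `v`. -/
def tau {A : Type*} [DecidableEq A] {n : ℕ} (u v : Fin n → A) : GateFun A n :=
  Equiv.swap u v

/-- The controlled gate `w-F`, mapping `w u` to `w F(u)` and fixing all other inputs. -/
def controlled {A : Type*} [DecidableEq A] {l n : ℕ} (w : Fin l → A) (F : GateFun A n) :
    GateFun A (l + n) :=
  ((splitEquiv A l n).trans
    (Equiv.prodCongrRight fun p => if p = w then F else Equiv.refl _)).trans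
    (splitEquiv A l n).symm

/-- `SWAP_{a,b}` for single symbols `a`, `b`: exchanges `ab` and `ba`. -/
def swapGate {A : Type*} [DecidableEq A] (a b : A) : GateFun A 2 :=
  tau ![a, b] ![b, a]

/-- Number of occurrences of the symbol `a` in the string `x`. -/
def countOf {A : Type*} [DecidableEq A] {n : ℕ} (a : A) (x : Fin n → A) : ℕ :=
  (Finset.univ.filter fun i => x i = a).card

theorem splitEquiv_symm_apply {A : Type*} {n m : ℕ} (u : Fin n → A) (v : Fin m → A) :
    (splitEquiv A n m).symm (u, v) = Fin.append u v := by
  ext i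
  refine Fin.addCases (fun i => ?_) (fun i => ?_) i <;>
    simp [splitEquiv, Equiv.sumArrowEquivProdArrow, Equiv.arrowCongr]

theorem splitEquiv_append {A : Type*} {n m : ℕ} (u : Fin n → A) (v : Fin m → A) :
    splitEquiv A n m (Fin.append u v) = (u, v) := by
  rw [← splitEquiv_symm_apply, Equiv.apply_symm_apply]

theorem tensorGate_append {A : Type*} {n m : ℕ} (F : GateFun A n) (G : GateFun A m)
    (u : Fin n → A) (v : Fin m → A) :
    tensorGate F G (Fin.append u v) = Fin.append (F u) (G v) := by
  simp [tensorGate, splitEquiv_append, splitEquiv_symm_apply]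

theorem controlled_append {A : Type*} [DecidableEq A] {l n : ℕ} (w u : Fin l → A)
    (F : GateFun A n) (v : Fin n → A) :
    controlled w F (Fin.append u v) = Fin.append u (if u = w then F v else v) := by
  by_cases h : u = w <;> simp [controlled, splitEquiv_append, splitEquiv_symm_apply, h]

/-- A gate class contains the uncontrolled version of each controlled gate it contains. -/
theorem Generates.of_controlled {A : Type*} [DecidableEq A] {S : Set (Gate A)} {l n : ℕ}
    {w : Fin l → A} {F : GateFun A n} (h : Generates S ⟨l + n, controlled w F⟩) :
    Generates S ⟨n, F⟩ :=
  .ancilla w h fun b => by simp [splitEquiv_symm_apply, controlled_append]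

theorem Generates.refl {A : Type*} {S : Set (Gate A)} (n : ℕ) :
    Generates S ⟨n, Equiv.refl _⟩ :=
  Generates.perm n 1

theorem swapGate_self {A : Type*} [DecidableEq A] (a : A) : swapGate a a = Equiv.refl _ :=
  Equiv.swap_self _

theorem swapGate_apply {A : Type*} [DecidableEq A] (a b p q : A) :
    swapGate a b ![p, q] =
      if p = a ∧ q = b then ![b, a] else if p = b ∧ q = a then ![a, b] else ![p, q] := by
  simp [swapGate, tau, Equiv.swap_apply_def, funext_iff, Fin.forall_fin_two]

theorem swapGate_swapGate {A : Type*} [DecidableEq A] (a b : A) (v : Fin 2 → A) :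
    swapGate a b (swapGate a b v) = v :=
  Equiv.swap_apply_self _ _ _

theorem controlled_refl {A : Type*} [DecidableEq A] {l n : ℕ} (w : Fin l → A) :
    controlled w (Equiv.refl (Fin n → A)) = Equiv.refl _ := by
  ext x : 1
  exact (splitEquiv A l n).symm_apply_eq.2 (by simp [Equiv.prodCongrRight])

theorem append_two {A : Type*} (p q : A) (v : Fin 2 → A) :
    Fin.append ![p, q] v = ![p, q, v 0, v 1] := by
  ext i; fin_cases i <;> rfl

theorem append_one_append_one {A : Type*} (p q : A) (v : Fin 2 → A) :
    Fin.append ![p] (Fin.append ![q] v) = ![p, q, v 0, v 1] := by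
  ext i; fin_cases i <;> rfl

theorem permGate_swap_zero_one {A : Type*} (p q r s : A) :
    permGate A (Equiv.swap (0 : Fin 4) 1) ![p, q, r, s] = ![q, p, r, s] := by
  ext i; fin_cases i <;> rfl

/-- A control on `o` and an unconditional `SWAP_{o,c}` simulate a control on `c`, using one
ancilla that starts as `o` and is turned into `c` exactly when the control wire holds `c`. -/
theorem Generates.controlled_swapGate_of_ne {A : Type*} [DecidableEq A] {S : Set (Gate A)}
    {o c a b : A} (hc : c ≠ o) (hoc : Generates S ⟨2, swapGate o c⟩)
    (hab : Generates S ⟨1 + 2, controlled ![o] (swapGate a b)⟩) :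
    Generates S ⟨1 + 2, controlled ![c] (swapGate a b)⟩ := by
  have hU : Generates S ⟨2, swapGate a b⟩ := hab.of_controlled
  let G₁ : GateFun A 4 := tensorGate (n := 2) (m := 2) (swapGate o c) (Equiv.refl _)
  let G₂ : GateFun A 4 := tensorGate (n := 2) (m := 2) (Equiv.refl _) (swapGate a b)
  let T : GateFun A 4 :=
    tensorGate (n := 1) (m := 1 + 2) (Equiv.refl _) (controlled ![o] (swapGate a b))
  let P : GateFun A 4 := permGate A (Equiv.swap (0 : Fin 4) 1)
  have h₁ : Generates S ⟨4, G₁⟩ := hoc.tensor (.refl 2)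
  have h₂ : Generates S ⟨4, G₂⟩ := (Generates.refl 2).tensor hU
  have hT : Generates S ⟨4, T⟩ := (Generates.refl 1).tensor hab
  have hP : Generates S ⟨4, P⟩ := .perm 4 _
  have e₁ (p q : A) (v : Fin 2 → A) :
      G₁ ![p, q, v 0, v 1] = Fin.append (swapGate o c ![p, q]) v := by
    rw [← append_two]; exact tensorGate_append _ _ _ _
  have e₂ (p q : A) (v : Fin 2 → A) :
      G₂ ![p, q, v 0, v 1] = ![p, q, swapGate a b v 0, swapGate a b v 1] := by
    rw [← append_two, ← append_two]; exact tensorGate_append _ _ _ _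
  have eP (p q r s : A) : P ![p, q, r, s] = ![q, p, r, s] := permGate_swap_zero_one p q r s
  have eT (p q : A) (v : Fin 2 → A) :
      T ![p, q, v 0, v 1] = Fin.append ![p] (Fin.append ![q]
        (if q = o then swapGate a b v else v)) := by
    rw [← append_one_append_one]
    refine (tensorGate_append _ _ _ _).trans ?_
    rw [controlled_append]
    simp
  let F : GateFun A 4 := ((((G₁.trans G₂).trans P).trans T).trans P).trans G₁
  have hF : Generates S ⟨1 + (1 + 2), F⟩ :=
    .comp h₁ (.comp hP (.comp hT (.comp hP (.comp h₂ h₁))))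
  refine .ancilla ![o] hF fun x => ?_
  obtain ⟨q, v, rfl⟩ : ∃ (q : A) (v : Fin 2 → A), x = Fin.append ![q] v :=
    ⟨x 0, ![x 1, x 2], by ext i; fin_cases i <;> rfl⟩
  rw [splitEquiv_symm_apply, splitEquiv_symm_apply, controlled_append]
  simp only [append_one_append_one]
  change G₁ (P (T (P (G₂ (G₁ ![o, q, v 0, v 1]))))) = _
  rw [e₁, swapGate_apply]
  by_cases hq : q = c
  · subst hq
    simp only [and_self, if_true, append_two, e₂, eP, eT, append_one_append_one, if_neg hc, e₁,
      swapGate_apply]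
    simp [hc, append_two]
  · simp only [hq, and_false, if_false, hc.symm, false_and, append_two, e₂, eP, eT,
      append_one_append_one, if_true, e₁, swapGate_apply, swapGate_swapGate]
    simp [hq]

/-- Over `A = {1,…,k}` with `k ≥ 3`, the set `S` of gates `1-SWAP_{a,b}` for all
`a ≠ b ∈ A` generates `c-SWAP_{a,b}` for all `a, b, c ∈ A`. -/
theorem generates_cswap (k : ℕ) (hk : 3 ≤ k) (a b c : Fin k) :
    Generates {g : Gate (Fin k) | ∃ a b : Fin k, a ≠ b ∧
      g = ⟨1 + 2, controlled ![(⟨0, by omega⟩ : Fin k)] (swapGate a b)⟩}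
      ⟨1 + 2, controlled ![c] (swapGate a b)⟩ := by
  by_cases hab : a = b
  · subst hab
    rw [swapGate_self, controlled_refl]
    exact .refl _
  by_cases hc : c = ⟨0, by omega⟩
  · subst hc
    exact .mem ⟨a, b, hab, rfl⟩
  · refine .controlled_swapGate_of_ne hc (Generates.of_controlled (w := ![⟨0, by omega⟩]) ?_)
      (.mem ⟨a, b, hab, rfl⟩)
    exact .mem ⟨_, c, Ne.symm hc, rfl⟩
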